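/- Let G be a finite group and χ an irreducible complex character of G such that χ(1) divides ψ(1) for every irreducible complex character ψ of G with ψ(1) > 1. Then χ is regular invertible, i.e., there exists a virtual character φ of G with χ·φ = ρ_reg (equivalently K(χ) = 1). -/

import Mathlib

open scoped ComplexOrder

noncomputable section

/-- `χ : G → ℂ` is an irreducible character: the character of a simple
finite-dimensional complex representation of `G`. -/
def IsIrrChar (G : Type) [Group G] (χ : G → ℂ) : Prop :=
  ∃ V : FDRep ℂ G, CategoryTheory.Simple V ∧ χ = V.character

/-- A virtual character is a `ℤ`-linear combination of irreducible characters. -/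
def IsVirtualChar (G : Type) [Group G] (χ : G → ℂ) : Prop :=
  χ ∈ Submodule.span ℤ {f : G → ℂ | IsIrrChar G f}

open Classical in
/-- The regular character: `|G|` at the identity, `0` elsewhere. -/
def regChar (G : Type) [Group G] : G → ℂ :=
  fun g => if g = 1 then (Nat.card G : ℂ) else 0

/-- The Knutson index of `χ`: the least positive `n` such that `χ·φ = n·ρ_reg`
for some virtual character `φ`. -/
def KnutsonIndex (G : Type) [Group G] (χ : G → ℂ) : ℕ :=
  sInf {n : ℕ | 0 < n ∧ ∃ φ : G → ℂ, IsVirtualChar G φ ∧ χ * φ = n • regChar G}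

/-- `ℂ[G]` is of Knutson type: every irreducible character is regular invertible. -/
def IsKnutsonType (G : Type) [Group G] : Prop :=
  ∀ χ : G → ℂ, IsIrrChar G χ → ∃ φ : G → ℂ, IsVirtualChar G φ ∧ χ * φ = regChar G

/-- Savitskii's preorder: `φ ≤ χ` iff `φ(1) ≤ χ(1)` and every zero of `χ` is a zero of `φ`. -/
def SavitskiiLE (G : Type) [Group G] (φ χ : G → ℂ) : Prop :=
  φ 1 ≤ χ 1 ∧ ∀ g : G, χ g = 0 → φ g = 0

/-- A virtual character of positive degree is Savitskii-minimal if every virtual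
character of positive degree below it is also above it. -/
def SavitskiiMinimal (G : Type) [Group G] (χ : G → ℂ) : Prop :=
  ∀ φ : G → ℂ, IsVirtualChar G φ → 0 < φ 1 → SavitskiiLE G φ χ → SavitskiiLE G χ φ

end

open CategoryTheory Representation

/-- The pairing `|G|⁻¹ ∑ f(g) h(g⁻¹)` on functions `G → ℂ`, linear in the first variable. -/
noncomputable def charPairing {G : Type} [Group G] [Finite G] (h : G → ℂ) :
    (G → ℂ) →ₗ[ℂ] ℂ where
  toFun f := (Nat.card G : ℂ)⁻¹ * ∑ g ∈ @Finset.univ G (Fintype.ofFinite G), f g * h g⁻¹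
  map_add' f₁ f₂ := by simp [add_mul, Finset.sum_add_distrib, mul_add]
  map_smul' c f := by
    simp only [Pi.smul_apply, smul_eq_mul, mul_assoc, ← Finset.mul_sum, RingHom.id_apply]
    ring

section Characters

variable {G : Type} [Group G]

theorem trace_eq_trace_restrict_add_of_isCompl {K V : Type*} [Field K] [AddCommGroup V]
    [Module K V] [FiniteDimensional K V] {p q : Submodule K V} (hpq : IsCompl p q)
    (f : V →ₗ[K] V) (hp : ∀ v ∈ p, f v ∈ p) (hq : ∀ v ∈ q, f v ∈ q) :
    LinearMap.trace K V f =
      LinearMap.trace K p (f.restrict hp) + LinearMap.trace K q (f.restrict hq) := by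
  have h : f = (Submodule.prodEquivOfIsCompl p q hpq).conj
      ((f.restrict hp).prodMap (f.restrict hq)) := by
    ext v
    obtain ⟨⟨a, b⟩, rfl⟩ := (Submodule.prodEquivOfIsCompl p q hpq).surjective v
    simp [LinearEquiv.conj_apply_apply]
  conv_lhs => rw [h]
  rw [LinearMap.trace_conj', LinearMap.trace_prodMap']

theorem isIrrChar_of_norm_one [Fintype G] (V : FDRep ℂ G)
    (h : ∑ g, V.character g * V.character g⁻¹ = Nat.card G) : IsIrrChar G V.character :=
  ⟨V, V.simple_iff_char_is_norm_one.2 h, rfl⟩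

theorem isIrrChar_of_isIrreducible [Finite G] {V : Type} [AddCommGroup V] [Module ℂ V]
    [FiniteDimensional ℂ V] (ρ : Representation ℂ G V) [IsIrreducible ρ] :
    IsIrrChar G ρ.character := by
  have := Fintype.ofFinite G
  have hG : (Nat.card G : ℂ) ≠ 0 := NeZero.ne _
  have := invertibleOfNonzero hG
  refine isIrrChar_of_norm_one (FDRep.of ρ) ?_
  have h := char_orthonormal ρ ρ
  rw [if_pos ⟨Representation.Equiv.refl ρ⟩, inv_mul_eq_one₀ hG] at h
  exact h.symm

theorem exists_multiset_isIrrChar [Finite G] {V : Type} [AddCommGroup V] [Module ℂ V]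
    [FiniteDimensional ℂ V] (ρ : Representation ℂ G V) :
    ∃ s : Multiset (G → ℂ), (∀ ψ ∈ s, IsIrrChar G ψ) ∧ ρ.character = s.sum := by
  induction hn : Module.finrank ℂ V using Nat.strong_induction_on generalizing V with
  | _ n ih =>
  subst hn
  by_cases hV : Subsingleton V
  · refine ⟨0, by simp, ?_⟩
    ext g
    simp [Representation.character, Subsingleton.elim (ρ g) 0]
  by_cases hirr : IsIrreducible ρ
  · exact ⟨{ρ.character}, by simpa using isIrrChar_of_isIrreducible ρ, by simp⟩
  have hnt : Nontrivial (Subrepresentation ρ) := by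
    refine ⟨⊥, ⊤, fun h => hV ?_⟩
    have h' : (⊥ : Submodule ℂ V) = ⊤ := congrArg Subrepresentation.toSubmodule h
    exact (Submodule.subsingleton_iff ℂ).1 (subsingleton_of_bot_eq_top h')
  obtain ⟨p, hp⟩ : ∃ p : Subrepresentation ρ, ¬ (p = ⊥ ∨ p = ⊤) := by
    by_contra! h
    exact hirr ⟨h⟩
  rw [not_or] at hp
  obtain ⟨q, hpq⟩ := exists_isCompl p
  have hc : IsCompl p.toSubmodule q.toSubmodule :=
    IsCompl.of_eq (congrArg Subrepresentation.toSubmodule hpq.inf_eq_bot)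
      (congrArg Subrepresentation.toSubmodule hpq.sup_eq_top)
  have hlt : ∀ r : Subrepresentation ρ, r ≠ ⊤ →
      Module.finrank ℂ r.toSubmodule < Module.finrank ℂ V := fun r hr =>
    Submodule.finrank_lt fun h => hr (Subrepresentation.toSubmodule_injective h)
  have hq : q ≠ ⊤ := by
    rintro rfl
    exact hp.1 (eq_bot_of_isCompl_top hpq)
  obtain ⟨s, hs, hs'⟩ := ih _ (hlt p hp.2) p.toRepresentation rfl
  obtain ⟨t, ht, ht'⟩ := ih _ (hlt q hq) q.toRepresentation rfl
  refine ⟨s + t, fun ψ hψ => (Multiset.mem_add.1 hψ).elim (hs ψ) (ht ψ), ?_⟩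
  rw [Multiset.sum_add, ← hs', ← ht']
  ext g
  exact trace_eq_trace_restrict_add_of_isCompl hc (ρ g) (p.apply_mem_toSubmodule g)
    (q.apply_mem_toSubmodule g)

open Classical in
theorem charPairing_of_isIrrChar [Finite G] {ψ η : G → ℂ} (hψ : IsIrrChar G ψ)
    (hη : IsIrrChar G η) : charPairing η ψ = if ψ = η then 1 else 0 := by
  obtain ⟨V, hV, rfl⟩ := hψ
  obtain ⟨W, hW, rfl⟩ := hη
  let := Fintype.ofFinite G
  have := invertibleOfNonzero (NeZero.ne (Nat.card G : ℂ))
  split_ifs with h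
  · rw [← h]
    exact (FDRep.char_orthonormal V V).trans (if_pos ⟨Iso.refl V⟩)
  · exact (FDRep.char_orthonormal V W).trans (if_neg fun ⟨i⟩ => h (FDRep.char_iso i))

open Classical in
theorem charPairing_multiset_sum [Finite G] {η : G → ℂ} (hη : IsIrrChar G η)
    {s : Multiset (G → ℂ)} (hs : ∀ ψ ∈ s, IsIrrChar G ψ) :
    charPairing η s.sum = s.count η := by
  induction s using Multiset.induction_on with
  | empty => simp
  | cons ψ s ih =>
    rw [Multiset.forall_mem_cons] at hs
    rw [Multiset.sum_cons, map_add, ih hs.2, charPairing_of_isIrrChar hs.1 hη,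
      Multiset.count_cons]
    by_cases h : ψ = η
    · simp [h, add_comm]
    · simp [h, Ne.symm h]

theorem charPairing_mul [Finite G] (lin η f : G → ℂ) :
    charPairing (lin * η) f = charPairing lin fun g => η g⁻¹ * f g := by
  simp only [charPairing, LinearMap.coe_mk, AddHom.coe_mk]
  congr 1
  refine Finset.sum_congr rfl fun g _ => ?_
  rw [Pi.mul_apply]
  ring

theorem charPairing_regChar [Finite G] (η : G → ℂ) : charPairing η (regChar G) = η 1 := by
  classical
  have hG : (Nat.card G : ℂ) ≠ 0 := NeZero.ne _
  simp [charPairing, regChar, inv_mul_cancel_left₀ hG]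

theorem exists_representation_character_eq_regChar (G : Type) [Group G] [Finite G] :
    ∃ ρ : Representation ℂ G (G → ℂ), ρ.character = regChar G := by
  classical
  have := Fintype.ofFinite G
  refine ⟨{ toFun g := LinearMap.funLeft ℂ ℂ (· * g)
            map_one' := by ext; simp [LinearMap.funLeft]
            map_mul' g h := by ext; simp [LinearMap.funLeft, mul_assoc] }, ?_⟩
  ext g
  simp only [Representation.character, regChar, MonoidHom.coe_mk, OneHom.coe_mk]
  rw [LinearMap.trace_eq_matrix_trace ℂ (Pi.basisFun ℂ G)]
  simp [Matrix.trace, LinearMap.funLeft, Pi.single_apply]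

theorem IsIrrChar.exists_degree {ψ : G → ℂ} (hψ : IsIrrChar G ψ) :
    ∃ m : ℕ, 0 < m ∧ ψ 1 = m := by
  obtain ⟨V, hV, rfl⟩ := hψ
  refine ⟨_, Nat.pos_of_ne_zero fun h => ?_, V.char_one⟩
  have : Subsingleton V := Module.finrank_zero_iff.1 h
  apply Simple.not_isZero V
  rw [Limits.IsZero.iff_id_eq_zero]
  ext x
  exact Subsingleton.elim (α := V) _ _

theorem FDRep.character_mul_character_inv_of_degree_one (V : FDRep ℂ G) (hV : V.character 1 = 1)
    (g : G) : V.character g * V.character g⁻¹ = 1 := by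
  rw [FDRep.char_one, Nat.cast_eq_one] at hV
  let b := Module.finBasisOfFinrankEq ℂ V hV
  have h : ∀ f : V →ₗ[ℂ] V, LinearMap.trace ℂ V f = LinearMap.det f := fun f => by
    rw [LinearMap.trace_eq_matrix_trace ℂ b, ← LinearMap.det_toMatrix b, Matrix.trace_fin_one,
      Matrix.det_fin_one]
  rw [FDRep.character, FDRep.character, h, h, ← map_mul, ← map_mul]
  simp

theorem IsIrrChar.mul_of_degree_one [Finite G] {ψ lin : G → ℂ} (hψ : IsIrrChar G ψ)
    (hlin : IsIrrChar G lin) (h1 : lin 1 = 1) : IsIrrChar G (lin * ψ) := by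
  have := Fintype.ofFinite G
  obtain ⟨V, hV, rfl⟩ := hψ
  obtain ⟨L, hL, rfl⟩ := hlin
  rw [← FDRep.char_tensor]
  apply isIrrChar_of_norm_one
  rw [← V.simple_iff_char_is_norm_one.1 hV, FDRep.char_tensor]
  refine Finset.sum_congr rfl fun g _ => ?_
  rw [Pi.mul_apply, Pi.mul_apply, mul_mul_mul_comm,
    L.character_mul_character_inv_of_degree_one h1, one_mul]

end Characters

section DegreeDvd

open Classical

variable {G : Type} [Group G] {d : ℕ}

theorem exists_multiset_sum_degree_eq
    (hdiv : ∀ ψ : G → ℂ, IsIrrChar G ψ → ∀ m : ℕ, ψ 1 = (m : ℂ) → 1 < m → d ∣ m)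
    {linChars : Finset (G → ℂ)} (hlin : ∀ ψ, ψ ∈ linChars ↔ IsIrrChar G ψ ∧ ψ 1 = 1)
    (s : Multiset (G → ℂ)) (hs : ∀ ψ ∈ s, IsIrrChar G ψ) :
    ∃ k : ℕ, s.sum 1 = ((∑ lin ∈ linChars, s.count lin + d * k : ℕ) : ℂ) := by
  induction s using Multiset.induction_on with
  | empty => exact ⟨0, by simp⟩
  | cons ψ s ih =>
    rw [Multiset.forall_mem_cons] at hs
    obtain ⟨k, hk⟩ := ih hs.2
    obtain ⟨m, hm, hψm⟩ := hs.1.exists_degree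
    simp only [Multiset.sum_cons, Pi.add_apply, hk, Multiset.count_cons, Finset.sum_add_distrib,
      Finset.sum_ite_eq', hlin, hs.1, true_and]
    by_cases h : ψ 1 = 1
    · exact ⟨k, by rw [if_pos h, h]; push_cast; ring⟩
    · obtain ⟨c, rfl⟩ := hdiv ψ hs.1 m hψm
        (Nat.lt_of_le_of_ne hm fun h' => h (by rw [hψm, ← h', Nat.cast_one]))
      exact ⟨c + k, by rw [if_neg h, hψm]; push_cast; ring⟩

theorem dvd_card_filter_mul_eq [Finite G] {χ : G → ℂ} (hχ : IsIrrChar G χ) (hd : χ 1 = (d : ℂ))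
    (hdiv : ∀ ψ : G → ℂ, IsIrrChar G ψ → ∀ m : ℕ, ψ 1 = (m : ℂ) → 1 < m → d ∣ m)
    {linChars : Finset (G → ℂ)} (hlin : ∀ ψ, ψ ∈ linChars ↔ IsIrrChar G ψ ∧ ψ 1 = 1)
    {lin₀ : G → ℂ} (h₀ : lin₀ ∈ linChars) :
    d ∣ (linChars.filter fun lin => lin * χ = lin₀ * χ).card := by
  rw [hlin] at h₀
  have hχ₀ := hχ.mul_of_degree_one h₀.1 h₀.2
  obtain ⟨V, hV, rfl⟩ := id hχ
  obtain ⟨W, hW, hWχ⟩ := id hχ₀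
  obtain ⟨s, hs, hs'⟩ := exists_multiset_isIrrChar (linHom V.ρ W.ρ)
  have hval : ∀ g, s.sum g = V.character g⁻¹ * (lin₀ * V.character) g := fun g => by
    rw [← hs', hWχ]
    exact char_linHom V.ρ W.ρ g
  have hcount : ∀ lin ∈ linChars,
      s.count lin = if lin * V.character = lin₀ * V.character then 1 else 0 := fun lin hl => by
    rw [hlin] at hl
    have h := charPairing_of_isIrrChar hχ₀ (hχ.mul_of_degree_one hl.1 hl.2)
    rw [charPairing_mul, ← funext hval, charPairing_multiset_sum hl.1 hs] at h
    rw [eq_comm (a := lin * _)]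
    exact_mod_cast h
  obtain ⟨k, hk⟩ := exists_multiset_sum_degree_eq hdiv hlin s hs
  rw [Finset.sum_congr rfl hcount, ← Finset.card_filter, hval, inv_one, Pi.mul_apply, h₀.2, hd,
    one_mul] at hk
  have hk' : d * d = (linChars.filter fun lin => lin * V.character = lin₀ * V.character).card +
    d * k := by exact_mod_cast hk
  exact (Nat.dvd_add_left (dvd_mul_right d k)).1 (hk' ▸ dvd_mul_right d d)

theorem exists_isVirtualChar_sum_mul_eq [Finite G] {χ : G → ℂ} (hχ : IsIrrChar G χ)
    (hd : χ 1 = (d : ℂ))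
    (hdiv : ∀ ψ : G → ℂ, IsIrrChar G ψ → ∀ m : ℕ, ψ 1 = (m : ℂ) → 1 < m → d ∣ m)
    {linChars : Finset (G → ℂ)} (hlin : ∀ ψ, ψ ∈ linChars ↔ IsIrrChar G ψ ∧ ψ 1 = 1) :
    ∃ μ, IsVirtualChar G μ ∧ ∑ lin ∈ linChars, lin * χ = d • (χ * μ) := by
  have key : ∀ f ∈ linChars.image (· * χ), ∃ μ, IsVirtualChar G μ ∧
      (linChars.filter fun lin => lin * χ = f).card • f = d • (χ * μ) := by
    intro f hf
    obtain ⟨lin₀, h₀, rfl⟩ := Finset.mem_image.1 hf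
    obtain ⟨c, hc⟩ := dvd_card_filter_mul_eq hχ hd hdiv hlin h₀
    refine ⟨c • lin₀, Submodule.smul_of_tower_mem _ c
      (Submodule.subset_span ((hlin _).1 h₀).1), ?_⟩
    rw [hc, mul_smul, mul_smul_comm, mul_comm χ]
  choose! μ hμ hμ' using key
  refine ⟨∑ f ∈ linChars.image (· * χ), μ f, Submodule.sum_mem _ hμ, ?_⟩
  rw [Finset.mul_sum, Finset.smul_sum, ← Finset.sum_congr rfl hμ',
    Finset.sum_comp (fun f : G → ℂ => f) (· * χ)]

theorem exists_regChar_eq_sum_add [Finite G]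
    (hdiv : ∀ ψ : G → ℂ, IsIrrChar G ψ → ∀ m : ℕ, ψ 1 = (m : ℂ) → 1 < m → d ∣ m) :
    ∃ linChars : Finset (G → ℂ), (∀ ψ, ψ ∈ linChars ↔ IsIrrChar G ψ ∧ ψ 1 = 1) ∧
      ∃ θ, IsVirtualChar G θ ∧ regChar G = ∑ lin ∈ linChars, lin + d • θ := by
  obtain ⟨ρ, hρ⟩ := exists_representation_character_eq_regChar G
  obtain ⟨s, hs, hs'⟩ := exists_multiset_isIrrChar ρ
  rw [hρ] at hs'
  have hcount : ∀ ψ, IsIrrChar G ψ → ψ 1 = s.count ψ := fun ψ hψ => by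
    rw [← charPairing_regChar ψ, hs', charPairing_multiset_sum hψ hs]
  refine ⟨s.toFinset.filter fun ψ => ψ 1 = 1, fun ψ => ?_, ?_⟩
  · rw [Finset.mem_filter, Multiset.mem_toFinset]
    refine ⟨fun h => ⟨hs ψ h.1, h.2⟩, fun h => ⟨?_, h.2⟩⟩
    rw [← Multiset.count_ne_zero]
    intro h0
    simpa [h0, h.2] using hcount ψ h.1
  · have hdvd : ∀ ψ ∈ s.toFinset.filter (fun ψ => ¬ ψ 1 = 1),
        ∃ θ, IsVirtualChar G θ ∧ s.count ψ • ψ = d • θ := fun ψ hψ => by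
      rw [Finset.mem_filter, Multiset.mem_toFinset] at hψ
      have hirr := hs ψ hψ.1
      have hne : 1 ≠ s.count ψ := fun h => hψ.2 (by rw [hcount ψ hirr, ← h, Nat.cast_one])
      obtain ⟨c, hc⟩ := hdiv ψ hirr _ (hcount ψ hirr)
        ((Multiset.one_le_count_iff_mem.2 hψ.1).lt_of_ne hne)
      exact ⟨c • ψ, Submodule.smul_of_tower_mem _ c (Submodule.subset_span hirr),
        by rw [hc, mul_smul]⟩
    choose! θ hθ hθ' using hdvd
    refine ⟨_, Submodule.sum_mem _ hθ, ?_⟩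
    rw [Finset.smul_sum, ← Finset.sum_congr rfl hθ', hs', Finset.sum_multiset_count,
      ← Finset.sum_filter_add_sum_filter_not _ fun ψ : G → ℂ => ψ 1 = 1]
    congr 1
    refine Finset.sum_congr rfl fun ψ hψ => ?_
    rw [Finset.mem_filter, Multiset.mem_toFinset] at hψ
    have h1 : s.count ψ = 1 := by exact_mod_cast (hcount ψ (hs ψ hψ.1)).symm.trans hψ.2
    rw [h1, one_smul]

end DegreeDvd

/-- If the degree of an irreducible character `χ` of a finite group
divides the degree of every irreducible character of degree `> 1`, then `χ` is regular
invertible (its Knutson index is `1`). -/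
theorem degree_dvd_implies_regular_invertible {G : Type} [Group G] [Finite G]
    (χ : G → ℂ) (hχ : IsIrrChar G χ) (d : ℕ) (hd : χ 1 = (d : ℂ))
    (hdiv : ∀ ψ : G → ℂ, IsIrrChar G ψ → ∀ m : ℕ, ψ 1 = (m : ℂ) → 1 < m → d ∣ m) :
    ∃ φ : G → ℂ, IsVirtualChar G φ ∧ χ * φ = regChar G := by
  obtain ⟨linChars, hlin, θ, hθ, hreg⟩ := exists_regChar_eq_sum_add hdiv
  obtain ⟨μ, hμ, hsum⟩ := exists_isVirtualChar_sum_mul_eq hχ hd hdiv hlin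
  refine ⟨μ + θ, Submodule.add_mem _ hμ hθ, ?_⟩
  obtain ⟨m, hm, hχm⟩ := hχ.exists_degree
  have hd0 : (d : ℂ) ≠ 0 := by
    rw [← hd, hχm]
    exact_mod_cast hm.ne'
  have hmul : regChar G * χ = d • (χ * (μ + θ)) := by
    rw [hreg, add_mul, Finset.sum_mul, hsum, smul_mul_assoc, mul_comm θ, mul_add, smul_add]
  ext g
  have hg := congrFun hmul g
  rw [Pi.smul_apply, nsmul_eq_mul, Pi.mul_apply] at hg
  apply mul_left_cancel₀ hd0
  rw [← hg]
  by_cases h : g = 1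
  · rw [h, hd, mul_comm]
  · simp [regChar, h]
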